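/- Let R be the 16×16 circulant matrix over F_2 whose first row is (1,1,0,0,1,0,1,1,0,0,1,1,0,1,0,1), and let C be the row space of the 16×32 matrix (I_16 | R). Then C is an even [32,16] code with minimum weight 8 which is not self-dual, and it has exactly 348 codewords of weight 8, 2176 codewords of weight 10, and 6272 codewords of weight 12. -/

import Mathlib

/-- The (Hamming) weight of a vector over `ZMod 2`. -/
def wt {ι : Type*} [Fintype ι] (x : ι → ZMod 2) : ℕ :=
  (Finset.univ.filter fun i => x i ≠ 0).card

/-- The dual code of a binary linear code. -/
def dualCode {ι : Type*} [Fintype ι] (C : Submodule (ZMod 2) (ι → ZMod 2)) :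
    Submodule (ZMod 2) (ι → ZMod 2) where
  carrier := {x | ∀ c ∈ C, ∑ i, x i * c i = 0}
  zero_mem' := by intro c _; simp
  add_mem' := by
    intro a b ha hb c hc
    simp only [Set.mem_setOf_eq] at ha hb ⊢
    simp [Pi.add_apply, add_mul, Finset.sum_add_distrib, ha c hc, hb c hc]
  smul_mem' := by
    intro r a ha c hc
    simp only [Set.mem_setOf_eq] at ha ⊢
    simp [Pi.smul_apply, smul_eq_mul, mul_assoc, ← Finset.mul_sum, ha c hc]

/-- A binary linear code is self-dual if it equals its dual. -/
def IsSelfDual {ι : Type*} [Fintype ι] (C : Submodule (ZMod 2) (ι → ZMod 2)) : Prop :=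
  C = dualCode C

/-- A binary code is even if every codeword has even weight. -/
def IsEvenCode {ι : Type*} [Fintype ι] (C : Submodule (ZMod 2) (ι → ZMod 2)) : Prop :=
  ∀ c ∈ C, 2 ∣ wt c

/-- `C` has minimum weight `d`: some nonzero codeword has weight `d` and
no nonzero codeword has smaller weight. -/
def HasMinWt {ι : Type*} [Fintype ι] (C : Submodule (ZMod 2) (ι → ZMod 2)) (d : ℕ) : Prop :=
  (∃ c ∈ C, c ≠ 0 ∧ wt c = d) ∧ ∀ c ∈ C, c ≠ 0 → d ≤ wt c

/-- `Awt C i` is the number `A_i(C)` of codewords of `C` of weight `i`. -/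
noncomputable def Awt {ι : Type*} [Fintype ι]
    (C : Submodule (ZMod 2) (ι → ZMod 2)) (i : ℕ) : ℕ :=
  Set.ncard {c ∈ (C : Set (ι → ZMod 2)) | wt c = i}

/-- `C` performs better than `C'`: the weight distribution of `C` is
lexicographically smaller than that of `C'`. -/
def LexSmaller {ι : Type*} [Fintype ι]
    (C C' : Submodule (ZMod 2) (ι → ZMod 2)) : Prop :=
  ∃ s : ℕ, (∀ i < s, Awt C i = Awt C' i) ∧ Awt C s < Awt C' s

/-- A circulant matrix: each row is the cyclic shift (by one position) of the previous one,
equivalently the matrix is invariant under simultaneously cyclically shifting rows and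
columns. -/
def IsCirculant {n : ℕ} (R : Matrix (Fin n) (Fin n) (ZMod 2)) : Prop :=
  ∀ i j k : Fin n, R (i + k) (j + k) = R i j

/-- The generator matrix `(I_n | R)`. -/
def genMat {n : ℕ} (R : Matrix (Fin n) (Fin n) (ZMod 2)) :
    Matrix (Fin n) (Fin n ⊕ Fin n) (ZMod 2) :=
  Matrix.of fun i => Sum.elim (fun j => if i = j then (1 : ZMod 2) else 0) (R i)

/-- The row space (span of the rows) of a matrix over `ZMod 2`. -/
def rowSpan {ι κ : Type*} (M : Matrix ι κ (ZMod 2)) : Submodule (ZMod 2) (κ → ZMod 2) :=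
  Submodule.span (ZMod 2) (Set.range M)

/-- The bordered matrix `B` with `B 0 0 = α`, the rest of the first row and first
column all ones, and remaining block the matrix `R'`. -/
def borderMat {m : ℕ} (α : ZMod 2) (R' : Matrix (Fin m) (Fin m) (ZMod 2)) :
    Matrix (Fin (m + 1)) (Fin (m + 1)) (ZMod 2) :=
  Matrix.of fun i j =>
    if hi : i = 0 then (if j = 0 then α else 1)
    else if hj : j = 0 then 1
    else R' (i.pred hi) (j.pred hj)

/-- `C` is a pure double circulant code of length `2n`. -/
def IsPureDC {n : ℕ} (C : Submodule (ZMod 2) (Fin n ⊕ Fin n → ZMod 2)) : Prop :=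
  ∃ R : Matrix (Fin n) (Fin n) (ZMod 2), IsCirculant R ∧ C = rowSpan (genMat R)

/-- `C` is a bordered double circulant code of length `2(m+1)`. -/
def IsBorderedDC {m : ℕ} (C : Submodule (ZMod 2) (Fin (m + 1) ⊕ Fin (m + 1) → ZMod 2)) : Prop :=
  ∃ (α : ZMod 2) (R' : Matrix (Fin m) (Fin m) (ZMod 2)),
    IsCirculant R' ∧ C = rowSpan (genMat (borderMat α R'))

/-- `C` is a double circulant code: pure or bordered. -/
def IsDC {m : ℕ} (C : Submodule (ZMod 2) (Fin (m + 1) ⊕ Fin (m + 1) → ZMod 2)) : Prop :=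
  IsPureDC C ∨ IsBorderedDC C

/-- The dual of a set of vectors. -/
def dualSet {ι : Type*} [Fintype ι] (X : Set (ι → ZMod 2)) : Set (ι → ZMod 2) :=
  {x | ∀ c ∈ X, ∑ i, x i * c i = 0}

/-- The shadow `S = C_0^⊥ \ C` of `C`, where `C_0` is the doubly even subcode. -/
def shadowSet {ι : Type*} [Fintype ι] (C : Submodule (ZMod 2) (ι → ZMod 2)) :
    Set (ι → ZMod 2) :=
  dualSet {c ∈ (C : Set (ι → ZMod 2)) | 4 ∣ wt c} \ (C : Set (ι → ZMod 2))

/-- The binary vector of length `n` whose entries are the low binary digits of `m`. -/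
def bitVector (n m : ℕ) : Fin n → ZMod 2 := fun i => if m.testBit i then 1 else 0

theorem bitVector_xor (n a b : ℕ) : bitVector n (a ^^^ b) = bitVector n a + bitVector n b := by
  funext i
  simp only [bitVector, Nat.testBit_xor, Pi.add_apply]
  cases a.testBit i <;> cases b.testBit i <;> decide

theorem wt_eq_sum {ι : Type*} [Fintype ι] (x : ι → ZMod 2) :
    wt x = ∑ i, (x i).val := by
  have h : ∀ a : ZMod 2, (if a ≠ 0 then 1 else 0) = a.val := by decide
  simp only [wt, Finset.card_filter, h]

theorem wt_cons {n : ℕ} (a : ZMod 2) (u : Fin n → ZMod 2) :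
    wt (Fin.cons a u : Fin (n + 1) → ZMod 2) = a.val + wt u := by
  simp only [wt_eq_sum, Fin.sum_univ_succ, Fin.cons_zero, Fin.cons_succ]

theorem wt_sumElim {ι κ : Type*} [Fintype ι] [Fintype κ] (x : ι → ZMod 2) (y : κ → ZMod 2) :
    wt (Sum.elim x y) = wt x + wt y := by
  simp only [wt_eq_sum, Fintype.sum_sum_type, Sum.elim_inl, Sum.elim_inr]

theorem wt_eq_zero_iff {ι : Type*} [Fintype ι] (x : ι → ZMod 2) : wt x = 0 ↔ x = 0 := by
  simp [wt, Finset.filter_eq_empty_iff, funext_iff]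

/-- The numbers of binary ones of `0, …, 15`, packed as base 16 digits. -/
def nibbleWeights : ℕ := 4841987667533046032

/-- The number of ones among the low four binary digits of `m`. -/
def nibbleWt (m : ℕ) : ℕ :=
  Nat.mod (Nat.shiftRight nibbleWeights (Nat.mul 4 (Nat.mod m 16))) 16

/-- The number of ones among the low sixteen binary digits of `m`. -/
def lowWt (m : ℕ) : ℕ :=
  Nat.add (Nat.add (nibbleWt m) (nibbleWt (Nat.shiftRight m 4)))
    (Nat.add (nibbleWt (Nat.shiftRight m 8)) (nibbleWt (Nat.shiftRight m 12)))

theorem lowWt_eq (m : ℕ) :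
    lowWt m = nibbleWt m + nibbleWt (m >>> 4) + (nibbleWt (m >>> 8) + nibbleWt (m >>> 12)) :=
  rfl

theorem nibbleWt_eq (m : ℕ) :
    nibbleWt m = (m.testBit 0).toNat + (m.testBit 1).toNat + (m.testBit 2).toNat
      + (m.testBit 3).toNat := by
  have h : ∀ k < 16, nibbleWt k = (k.testBit 0).toNat + (k.testBit 1).toNat
      + (k.testBit 2).toNat + (k.testBit 3).toNat := by decide
  have hm := h (m % 2 ^ 4) (Nat.mod_lt _ (by norm_num))
  simp only [Nat.testBit_mod_two_pow] at hm
  have hmod : nibbleWt (m % 2 ^ 4) = nibbleWt m := by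
    change (nibbleWeights >>> (4 * (m % 2 ^ 4 % 16))) % 16
      = (nibbleWeights >>> (4 * (m % 16))) % 16
    norm_num
  rw [hmod] at hm
  simpa using hm

theorem wt_bitVector (m : ℕ) : wt (bitVector 16 m) = lowWt m := by
  have h (b : Bool) : (if b then (1 : ZMod 2) else 0).val = b.toNat := by
    cases b <;> decide
  simp only [wt_eq_sum, bitVector, h, lowWt_eq, nibbleWt_eq, Nat.testBit_shiftRight,
    Fin.sum_univ_succ, Finset.univ_eq_empty, Finset.sum_empty]
  norm_num [-Nat.testBit_zero, Fin.succ]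
  ring

/-- The sum of `f` over the weights of the vectors `(u, y + uM)`, increased by `w`, where
`M` has the rows encoded by the list and `y` is encoded by `v`. -/
def weightSum (f : ℕ → ℕ) (rs : List ℕ) : ℕ → ℕ → ℕ :=
  rs.foldr (fun r k w v => Nat.add (k w v) (k (Nat.succ w) (Nat.xor v r))) fun w v =>
    f (Nat.add w (lowWt v))

theorem weightSum_eq (f : ℕ → ℕ) (rs : List ℕ) (w v : ℕ) :
    weightSum f rs w v = ∑ u : Fin rs.length → ZMod 2,
      f (w + (wt u + wt (bitVector 16 v + ∑ i, u i • bitVector 16 (rs.get i)))) := by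
  induction rs generalizing w v with
  | nil =>
    change f (w + lowWt v) = _
    simp [wt_bitVector, wt_eq_sum (ι := Fin 0)]
  | cons r rs ih =>
    have hstep : weightSum f (r :: rs) w v
        = weightSum f rs w v + weightSum f rs (w + 1) (v ^^^ r) := rfl
    have huniv (g : ZMod 2 → ℕ) : ∑ a, g a = g 0 + g 1 := Fin.sum_univ_two g
    rw [hstep, ih, ih]
    change _ = ∑ u : Fin (rs.length + 1) → ZMod 2, _
    rw [← (Fin.consEquiv fun _ : Fin (rs.length + 1) => ZMod 2).sum_comp,
      Fintype.sum_prod_type, huniv]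
    congr 1 <;> refine Finset.sum_congr rfl fun u _ => ?_
    · congr 2
      simp only [Fin.consEquiv, Equiv.coe_fn_mk, wt_cons]
      erw [Fin.sum_univ_succ]
      simp
    · simp only [Fin.consEquiv, Equiv.coe_fn_mk, wt_cons]
      erw [Fin.sum_univ_succ]
      simp [bitVector_xor, add_assoc, ZMod.val_one]

/-- Separates the weights 8, 10, 12 and the weights that must not occur into different
blocks of binary digits. -/
def weightMark (w : ℕ) : ℕ :=
  bif w.beq 8 then 1 else bif w.beq 10 then 2 ^ 20 else bif w.beq 12 then 2 ^ 40 else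
    bif Nat.beq (Nat.mod w 2) 1 then 2 ^ 60 else bif Nat.ble 8 w then 0 else
      bif w.beq 0 then 0 else 2 ^ 60

theorem weightMark_eq (w : ℕ) :
    weightMark w = (if w = 8 then 1 else 0) + 2 ^ 20 * (if w = 10 then 1 else 0)
      + 2 ^ 40 * (if w = 12 then 1 else 0)
      + 2 ^ 60 * (if w % 2 = 1 ∨ (1 ≤ w ∧ w ≤ 7) then 1 else 0) := by
  have hbeq (a b : ℕ) : a.beq b = decide (a = b) := by rw [Bool.eq_iff_iff]; simp
  have hble (a b : ℕ) : a.ble b = decide (a ≤ b) := by rw [Bool.eq_iff_iff]; simp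
  by_cases h8 : w = 8
  · subst h8; decide
  by_cases h10 : w = 10
  · subst h10; decide
  by_cases h12 : w = 12
  · subst h12; decide
  have hmod : w.mod 2 = w % 2 := rfl
  simp only [weightMark, hbeq, hble, h8, h10, h12, hmod, Bool.cond_eq_ite, decide_eq_true_eq,
    if_false, mul_zero, zero_add]
  split_ifs <;> omega

/-- The rows of the circulant matrix, read as binary numbers. -/
def circulantRows : List ℕ :=
  [44243, 22951, 45902, 26269, 52538, 39541, 13547, 27094,
   54188, 42841, 20147, 40294, 15053, 30106, 60212, 54889]

theorem weightSum_circulantRows :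
    weightSum weightMark circulantRows 0 0 = 348 + 2 ^ 20 * 2176 + 2 ^ 40 * 6272 := by
  decide +kernel

/-- The encoding of a message by the generator matrix `(I | R)`. -/
def encode {n : ℕ} (R : Matrix (Fin n) (Fin n) (ZMod 2)) :
    (Fin n → ZMod 2) →ₗ[ZMod 2] (Fin n ⊕ Fin n → ZMod 2) :=
  Fintype.linearCombination (ZMod 2) (genMat R)

theorem encode_apply {n : ℕ} (R : Matrix (Fin n) (Fin n) (ZMod 2)) (u : Fin n → ZMod 2) :
    encode R u = Sum.elim u (∑ i, u i • R i) := by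
  have h : encode R u = ∑ i, u i • genMat R i :=
    Fintype.linearCombination_apply (ZMod 2) (genMat R) u
  funext j
  rw [h]
  rcases j with j | j <;> simp [genMat]

theorem encode_injective {n : ℕ} (R : Matrix (Fin n) (Fin n) (ZMod 2)) :
    Function.Injective (encode R) := by
  intro u v h
  rw [encode_apply, encode_apply] at h
  exact funext fun i => congrFun h (Sum.inl i)

theorem range_encode {n : ℕ} (R : Matrix (Fin n) (Fin n) (ZMod 2)) :
    LinearMap.range (encode R) = rowSpan (genMat R) :=
  Fintype.range_linearCombination (ZMod 2) (genMat R)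

theorem finrank_rowSpan_genMat {n : ℕ} (R : Matrix (Fin n) (Fin n) (ZMod 2)) :
    Module.finrank (ZMod 2) (rowSpan (genMat R)) = n := by
  rw [← range_encode, LinearMap.finrank_range_of_inj (encode_injective R),
    Module.finrank_fin_fun]

theorem Awt_rowSpan_genMat {n : ℕ} (R : Matrix (Fin n) (Fin n) (ZMod 2)) (d : ℕ) :
    Awt (rowSpan (genMat R)) d = (Finset.univ.filter fun u => wt (encode R u) = d).card := by
  have h : {c ∈ (rowSpan (genMat R) : Set (Fin n ⊕ Fin n → ZMod 2)) | wt c = d}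
      = encode R '' (Finset.univ.filter fun u => wt (encode R u) = d : Finset _) := by
    ext c
    simp only [← range_encode, Finset.coe_filter, Set.mem_image, SetLike.mem_coe,
      LinearMap.mem_range, Finset.mem_univ, true_and]
    constructor
    · rintro ⟨⟨u, rfl⟩, hu⟩
      exact ⟨u, hu, rfl⟩
    · rintro ⟨u, hu, rfl⟩
      exact ⟨⟨u, rfl⟩, hu⟩
  rw [Awt, h, Set.ncard_image_of_injective _ (encode_injective R), Set.ncard_coe_finset]

theorem IsCirculant.apply_eq {n : ℕ} [NeZero n] {R : Matrix (Fin n) (Fin n) (ZMod 2)}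
    (hR : IsCirculant R) (i j : Fin n) : R i j = R 0 (j - i) := by
  simpa using hR 0 (j - i) i

theorem bitVector_circulantRows {R : Matrix (Fin 16) (Fin 16) (ZMod 2)} (hR : IsCirculant R)
    (h0 : R 0 = ![1, 1, 0, 0, 1, 0, 1, 1, 0, 0, 1, 1, 0, 1, 0, 1]) (i : Fin 16) :
    R i = bitVector 16 (circulantRows.get i) := by
  have h : ∀ i j : Fin 16,
      (![1, 1, 0, 0, 1, 0, 1, 1, 0, 0, 1, 1, 0, 1, 0, 1] : Fin 16 → ZMod 2) (j - i)
        = bitVector 16 (circulantRows.get i) j := by decide +kernel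
  funext j
  rw [hR.apply_eq, h0, h]

/-- The pure double circulant code `P_{32,1}`. -/
theorem stmt_15 (R : Matrix (Fin 16) (Fin 16) (ZMod 2)) (hR : IsCirculant R)
    (h0 : R 0 = ![1, 1, 0, 0, 1, 0, 1, 1, 0, 0, 1, 1, 0, 1, 0, 1]) :
    IsEvenCode (rowSpan (genMat R)) ∧
    Module.finrank (ZMod 2) (rowSpan (genMat R)) = 16 ∧
    HasMinWt (rowSpan (genMat R)) 8 ∧
    ¬ IsSelfDual (rowSpan (genMat R)) ∧
    Awt (rowSpan (genMat R)) 8 = 348 ∧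
    Awt (rowSpan (genMat R)) 10 = 2176 ∧
    Awt (rowSpan (genMat R)) 12 = 6272 := by
  have hrow := bitVector_circulantRows hR h0
  have hmark : ∑ u, weightMark (wt (encode R u))
      = 348 + 2 ^ 20 * 2176 + 2 ^ 40 * 6272 := by
    rw [← weightSum_circulantRows, weightSum_eq]
    refine Finset.sum_congr rfl fun u _ => ?_
    have hv : bitVector 16 0 = 0 := by funext i; simp [bitVector]
    rw [encode_apply, wt_sumElim, hv, zero_add, zero_add]
    simp only [hrow]
    rfl
  have hbound (p : (Fin 16 → ZMod 2) → Prop) [DecidablePred p] :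
      (Finset.univ.filter p).card ≤ 65536 :=
    (Finset.card_le_univ _).trans (by simp)
  simp only [weightMark_eq, Finset.sum_add_distrib, ← Finset.mul_sum,
    ← Finset.card_filter] at hmark
  have hb8 := hbound fun u => wt (encode R u) = 8
  have hb10 := hbound fun u => wt (encode R u) = 10
  have hb12 := hbound fun u => wt (encode R u) = 12
  have h8 : Awt (rowSpan (genMat R)) 8 = 348 := by rw [Awt_rowSpan_genMat]; omega
  have h10 : Awt (rowSpan (genMat R)) 10 = 2176 := by rw [Awt_rowSpan_genMat]; omega
  have h12 : Awt (rowSpan (genMat R)) 12 = 6272 := by rw [Awt_rowSpan_genMat]; omega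
  have hbad : (Finset.univ.filter fun u => wt (encode R u) % 2 = 1 ∨
      (1 ≤ wt (encode R u) ∧ wt (encode R u) ≤ 7)).card = 0 := by omega
  have hgood : ∀ c ∈ rowSpan (genMat R), wt c % 2 = 0 ∧ (wt c = 0 ∨ 8 ≤ wt c) := by
    intro c hc
    rw [← range_encode] at hc
    obtain ⟨u, rfl⟩ := hc
    have hu := Finset.filter_eq_empty_iff.mp (Finset.card_eq_zero.mp hbad) (Finset.mem_univ u)
    omega
  refine ⟨fun c hc => Nat.dvd_of_mod_eq_zero (hgood c hc).1, finrank_rowSpan_genMat R,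
    ⟨?_, fun c hc hne => ?_⟩, fun hself => ?_, h8, h10, h12⟩
  · obtain ⟨c, hc, hwt⟩ := Set.nonempty_of_ncard_ne_zero (h8.trans_ne (by norm_num))
    refine ⟨c, hc, fun hzero => ?_, hwt⟩
    rw [(wt_eq_zero_iff c).mpr hzero] at hwt
    norm_num at hwt
  · exact (hgood c hc).2.resolve_left fun h => hne ((wt_eq_zero_iff c).mp h)
  · have hmem (i : Fin 16) : genMat R i ∈ rowSpan (genMat R) :=
      Submodule.subset_span ⟨i, rfl⟩
    have hdual : genMat R 0 ∈ dualCode (rowSpan (genMat R)) := hself ▸ hmem 0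
    have horth := hdual (genMat R 3) (hmem 3)
    simp only [Fintype.sum_sum_type, genMat, Matrix.of_apply, Sum.elim_inl, Sum.elim_inr,
      hrow] at horth
    revert horth
    decide +kernel
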